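/- Let q = 3^n with n ≥ 3, let a ∈ F_q with a ≠ 0, and let r ∈ F_{q^3} with r ∉ F_q and r + r^q + r^{q^2} = 0. Write r_1 = r, r_2 = r^q, r_3 = r^{q^2}, and define f: F_q → F_{q^3} by f(x) = a·x + 1/(x − r_1) + 1/(x − r_2) + 1/(x − r_3). Then the sum over all x ∈ F_q of f(x)^4 equals 0, and the sum over all x ∈ F_q of f(x)^5 equals (a^2 / (r_1 − r_2)) · (1 − a^2·(r_1 − r_2)^4). -/

import Mathlib

section PowerSums

variable {F K : Type*} [Field F] [Fintype F] [Field K] [Algebra F K]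

local notation "ι" => algebraMap F K

theorem sum_algebraMap_pow_eq_zero {m : ℕ} (hm : m < Fintype.card F - 1) :
    ∑ x : F, (ι x) ^ m = 0 := by
  simpa using congrArg ι (FiniteField.sum_pow_lt_card_sub_one F m hm)

theorem sum_algebraMap_pow_card_sub_one :
    ∑ x : F, (ι x) ^ (Fintype.card F - 1) = -1 := by
  classical
  have hq : 1 < Fintype.card F := Fintype.one_lt_card
  have h : ∀ x : F, x ^ (Fintype.card F - 1) = 1 - if x = 0 then 1 else 0 := by
    intro x
    split_ifs with hx
    · rw [hx, zero_pow (by omega), sub_self]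
    · rw [FiniteField.pow_card_sub_one_eq_one x hx, sub_zero]
  have hF : ∑ x : F, x ^ (Fintype.card F - 1) = -1 := by
    simp_rw [h, Finset.sum_sub_distrib]
    simp
  simpa using congrArg ι hF

theorem sum_algebraMap_sub_pow_eq_zero (s : K) {m : ℕ} (hm : m < Fintype.card F - 1) :
    ∑ x : F, (ι x - s) ^ m = 0 := by
  simp_rw [sub_eq_add_neg, add_pow]
  rw [Finset.sum_comm]
  refine Finset.sum_eq_zero fun i hi => ?_
  have : i ≤ m := Finset.mem_range_succ_iff.mp hi
  simp_rw [mul_assoc, ← Finset.sum_mul]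
  rw [sum_algebraMap_pow_eq_zero (by omega), zero_mul]

theorem sum_algebraMap_sub_pow_card_sub_one (s : K) :
    ∑ x : F, (ι x - s) ^ (Fintype.card F - 1) = -1 := by
  simp_rw [sub_eq_add_neg, add_pow]
  rw [Finset.sum_comm, Finset.sum_range_succ, Finset.sum_eq_zero]
  · simp [sum_algebraMap_pow_card_sub_one]
  · intro i hi
    simp_rw [mul_assoc, ← Finset.sum_mul]
    rw [sum_algebraMap_pow_eq_zero (Finset.mem_range.mp hi), zero_mul]

theorem algebraMap_sub_pow_card (s : K) (x : F) :
    (ι x - s) ^ Fintype.card F = ι x - s ^ Fintype.card F := by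
  have h := map_sub (FiniteField.frobeniusAlgHom F K) (ι x) s
  simpa [-map_sub, ← map_pow, FiniteField.pow_card] using h

/-- An element of an extension of `F` fixed by the Frobenius of `F` lies in `F`. -/
theorem mem_range_algebraMap_of_pow_card_eq {s : K} (hs : s ^ Fintype.card F = s) :
    s ∈ Set.range ι := by
  by_contra h
  have hne : ∀ x : F, ι x - s ≠ 0 := fun x hx => h ⟨x, sub_eq_zero.mp hx⟩
  have hone : ∀ x : F, (ι x - s) ^ (Fintype.card F - 1) = 1 := by
    intro x
    refine mul_right_cancel₀ (hne x) ?_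
    rw [pow_sub_one_mul Fintype.card_ne_zero, algebraMap_sub_pow_card, hs, one_mul]
  have h1 := sum_algebraMap_sub_pow_card_sub_one (F := F) s
  have h0 : ((Fintype.card F : ℕ) : K) = 0 := by
    rw [← map_natCast ι, FiniteField.cast_card_eq_zero, map_zero]
  simp [hone, h0] at h1

theorem algebraMap_sub_ne_zero {s d : K} (hd : d ≠ 0) (hs : s ^ Fintype.card F = s - d) (x : F) :
    ι x - s ≠ 0 := by
  intro h
  rw [← sub_eq_zero.mp h, ← map_pow, FiniteField.pow_card, eq_comm, sub_eq_self] at hs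
  exact hd hs

/-- Power sums of the inverses `(x - s)⁻¹` when the Frobenius of `F` moves `s` to `s - d`. -/
theorem sum_inv_algebraMap_sub_pow {s d : K} (hd : d ≠ 0) (hs : s ^ Fintype.card F = s - d)
    {k : ℕ} (hk : k < Fintype.card F) :
    ∑ x : F, ((ι x - s)⁻¹) ^ (k + 1) = (-d⁻¹) ^ (k + 1) := by
  have hstep : ∀ (k : ℕ), k < Fintype.card F → ∀ x : F, ((ι x - s)⁻¹) ^ (k + 1) =
      d⁻¹ * ((ι x - s) ^ (Fintype.card F - 1 - k) - ((ι x - s)⁻¹) ^ k) := by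
    intro k hk x
    have hne := algebraMap_sub_ne_zero hd hs x
    have hfr : (ι x - s) ^ Fintype.card F = ι x - s + d := by
      rw [algebraMap_sub_pow_card, hs]; ring
    have hpow : (ι x - s) ^ (Fintype.card F - 1 - k) * (ι x - s) ^ (k + 1) = ι x - s + d := by
      rw [← pow_add, ← hfr]; congr 1; omega
    generalize (ι x - s) ^ (Fintype.card F - 1 - k) = v at hpow ⊢
    rw [eq_inv_mul_iff_mul_eq₀ hd, inv_pow, inv_pow, eq_sub_iff_add_eq]
    refine mul_right_cancel₀ (pow_ne_zero (k + 1) hne) ?_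
    rw [hpow]
    field_simp
    ring
  induction k with
  | zero =>
    have h0 : ((Fintype.card F : ℕ) : K) = 0 := by
      rw [← map_natCast ι, FiniteField.cast_card_eq_zero, map_zero]
    simp_rw [hstep 0 hk, ← Finset.mul_sum, Finset.sum_sub_distrib, Nat.sub_zero,
      sum_algebraMap_sub_pow_card_sub_one]
    simp [h0]
  | succ k ih =>
    simp_rw [hstep (k + 1) hk, ← Finset.mul_sum, Finset.sum_sub_distrib]
    rw [ih (by omega), sum_algebraMap_sub_pow_eq_zero s (by omega)]
    ring

/-- Mixed power sums of `x` and `(x - s)⁻¹`, by the binomial expansion of `x = (x - s) + s`. -/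
theorem sum_pow_mul_inv_algebraMap_sub_pow {s d : K} (hd : d ≠ 0)
    (hs : s ^ Fintype.card F = s - d) {j k : ℕ} (hj : j < Fintype.card F)
    (hk : k ≤ Fintype.card F) (hk0 : 0 < k) :
    ∑ x : F, ι x ^ j * ((ι x - s)⁻¹) ^ k =
      ∑ i ∈ Finset.range (j + 1), if i < k then s ^ (j - i) * j.choose i * (-d⁻¹) ^ (k - i)
        else 0 := by
  have hexp : ∀ x : F, ι x ^ j * ((ι x - s)⁻¹) ^ k = ∑ i ∈ Finset.range (j + 1),
      s ^ (j - i) * j.choose i * ((ι x - s) ^ i * ((ι x - s)⁻¹) ^ k) := by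
    intro x
    conv_lhs => rw [← sub_add_cancel (ι x) s, add_pow, Finset.sum_mul, sub_add_cancel]
    exact Finset.sum_congr rfl fun i _ => by ring
  simp_rw [hexp]
  rw [Finset.sum_comm]
  refine Finset.sum_congr rfl fun i hi => ?_
  have hij : i ≤ j := Finset.mem_range_succ_iff.mp hi
  rw [← Finset.mul_sum]
  split_ifs with hik
  · obtain ⟨m, rfl⟩ := Nat.exists_eq_add_of_lt hik
    rw [add_assoc, Nat.add_sub_cancel_left, ← sum_inv_algebraMap_sub_pow hd hs (by omega)]
    congr 1
    refine Finset.sum_congr rfl fun x _ => ?_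
    rw [pow_add _ i, ← mul_assoc, ← mul_pow, mul_inv_cancel₀ (algebraMap_sub_ne_zero hd hs x),
      one_pow, one_mul]
  · obtain ⟨m, rfl⟩ := Nat.exists_eq_add_of_le (not_lt.mp hik)
    refine mul_eq_zero_of_right _ ?_
    rw [← sum_algebraMap_sub_pow_eq_zero (F := F) s (m := m) (by omega)]
    refine Finset.sum_congr rfl fun x _ => ?_
    rw [add_comm k m, pow_add, mul_assoc, ← mul_pow,
      mul_inv_cancel₀ (algebraMap_sub_ne_zero hd hs x), one_pow, mul_one]

end PowerSums

section Telescoping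

variable {R : Type*} [CommRing R] {u v w c : R}

theorem add_add_pow_two_of_mul_eq (huv : u * v = c * (u - v)) (hvw : v * w = c * (v - w))
    (hwu : w * u = c * (w - u)) : (u + v + w) ^ 2 = u ^ 2 + v ^ 2 + w ^ 2 := by
  linear_combination 2 * huv + 2 * hvw + 2 * hwu

theorem add_add_pow_three_of_three_eq_zero (h3 : (3 : R) = 0) (u v w : R) :
    (u + v + w) ^ 3 = u ^ 3 + v ^ 3 + w ^ 3 := by
  linear_combination (u + v) * (v + w) * (w + u) * h3

theorem sq_mul_sq_of_mul_eq (huv : u * v = c * (u - v)) :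
    u ^ 2 * v ^ 2 = c ^ 2 * (u ^ 2 + v ^ 2) - 2 * c ^ 3 * (u - v) := by
  linear_combination (u * v + c * (u - v) - 2 * c ^ 2) * huv

theorem add_add_pow_four_of_mul_eq (h3 : (3 : R) = 0) (huv : u * v = c * (u - v))
    (hvw : v * w = c * (v - w)) (hwu : w * u = c * (w - u)) :
    (u + v + w) ^ 4 = u ^ 4 + v ^ 4 + w ^ 4 + c ^ 2 * (u ^ 2 + v ^ 2 + w ^ 2) := by
  have h2 := add_add_pow_two_of_mul_eq huv hvw hwu
  have hsq : (u + v + w) ^ 4 = (u ^ 2 + v ^ 2 + w ^ 2) ^ 2 := by rw [← h2]; ring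
  linear_combination hsq + 2 * sq_mul_sq_of_mul_eq huv + 2 * sq_mul_sq_of_mul_eq hvw +
    2 * sq_mul_sq_of_mul_eq hwu + c ^ 2 * (u ^ 2 + v ^ 2 + w ^ 2) * h3

theorem sq_mul_sq_mul_add_of_mul_eq (huv : u * v = c * (u - v)) :
    u ^ 2 * v ^ 2 * (u + v) = c ^ 2 * (u ^ 3 + v ^ 3) - c ^ 3 * (u ^ 2 - v ^ 2) := by
  linear_combination ((u * v + c * (u - v)) * (u + v) - c ^ 2 * (u + v)) * huv

theorem add_add_pow_five_of_mul_eq (h3 : (3 : R) = 0) (huv : u * v = c * (u - v))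
    (hvw : v * w = c * (v - w)) (hwu : w * u = c * (w - u)) :
    (u + v + w) ^ 5 = u ^ 5 + v ^ 5 + w ^ 5 - c ^ 2 * (u ^ 3 + v ^ 3 + w ^ 3) := by
  have h5 : (u + v + w) ^ 5 = (u ^ 2 + v ^ 2 + w ^ 2) * (u ^ 3 + v ^ 3 + w ^ 3) := by
    rw [← add_add_pow_two_of_mul_eq huv hvw hwu, ← add_add_pow_three_of_three_eq_zero h3]; ring
  linear_combination h5 + sq_mul_sq_mul_add_of_mul_eq huv + sq_mul_sq_mul_add_of_mul_eq hvw +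
    sq_mul_sq_mul_add_of_mul_eq hwu + c ^ 2 * (u ^ 3 + v ^ 3 + w ^ 3) * h3

theorem add_pow_four_of_mul_eq (h3 : (3 : R) = 0) (huv : u * v = c * (u - v))
    (hvw : v * w = c * (v - w)) (hwu : w * u = c * (w - u)) (a x : R) :
    (a * x + u + v + w) ^ 4 = a ^ 4 * x ^ 4
      + a ^ 3 * (x ^ 3 * u ^ 1 + x ^ 3 * v ^ 1 + x ^ 3 * w ^ 1)
      + a * (x ^ 1 * u ^ 3 + x ^ 1 * v ^ 3 + x ^ 1 * w ^ 3)
      + ((u ^ 4 + v ^ 4 + w ^ 4) + c ^ 2 * (u ^ 2 + v ^ 2 + w ^ 2)) := by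
  linear_combination add_add_pow_four_of_mul_eq h3 huv hvw hwu
    + 4 * a * x * add_add_pow_three_of_three_eq_zero h3 u v w
    + (a ^ 3 * x ^ 3 * (u + v + w) + 2 * a ^ 2 * x ^ 2 * (u + v + w) ^ 2
      + a * x * (u ^ 3 + v ^ 3 + w ^ 3)) * h3

theorem add_pow_five_of_mul_eq (h3 : (3 : R) = 0) (huv : u * v = c * (u - v))
    (hvw : v * w = c * (v - w)) (hwu : w * u = c * (w - u)) (a x : R) :
    (a * x + u + v + w) ^ 5 = a ^ 5 * x ^ 5
      - a ^ 4 * (x ^ 4 * u ^ 1 + x ^ 4 * v ^ 1 + x ^ 4 * w ^ 1)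
      + a ^ 3 * (x ^ 3 * u ^ 2 + x ^ 3 * v ^ 2 + x ^ 3 * w ^ 2)
      + a ^ 2 * (x ^ 2 * u ^ 3 + x ^ 2 * v ^ 3 + x ^ 2 * w ^ 3)
      - a * ((x ^ 1 * u ^ 4 + x ^ 1 * v ^ 4 + x ^ 1 * w ^ 4)
        + c ^ 2 * (x ^ 1 * u ^ 2 + x ^ 1 * v ^ 2 + x ^ 1 * w ^ 2))
      + ((u ^ 5 + v ^ 5 + w ^ 5) - c ^ 2 * (u ^ 3 + v ^ 3 + w ^ 3)) := by
  linear_combination add_add_pow_five_of_mul_eq h3 huv hvw hwu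
    + 5 * a * x * add_add_pow_four_of_mul_eq h3 huv hvw hwu
    + 10 * a ^ 2 * x ^ 2 * add_add_pow_three_of_three_eq_zero h3 u v w
    + 10 * a ^ 3 * x ^ 3 * add_add_pow_two_of_mul_eq huv hvw hwu
    + (2 * a ^ 4 * x ^ 4 * (u + v + w) + 3 * a ^ 3 * x ^ 3 * (u ^ 2 + v ^ 2 + w ^ 2)
      + 3 * a ^ 2 * x ^ 2 * (u ^ 3 + v ^ 3 + w ^ 3)
      + 2 * a * x * ((u ^ 4 + v ^ 4 + w ^ 4) + c ^ 2 * (u ^ 2 + v ^ 2 + w ^ 2))) * h3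

end Telescoping

/-- For `q = 3^n`, `n ≥ 3`, `a ∈ F_q*`, `r ∈ F_{q³} \ F_q` with `r + r^q + r^{q²} = 0`,
and `f(x) = a·x + 1/(x - r) + 1/(x - r^q) + 1/(x - r^{q²})`, `∑ f(x)⁴ = 0` and
`∑ f(x)⁵ = (a²/(r - r^q))·(1 - a²·(r - r^q)⁴)`. -/
theorem stmt_18 (n : ℕ) (hn : 3 ≤ n) (q : ℕ) (hq : q = 3 ^ n)
    (F K : Type*) [Field F] [Fintype F] [Field K] [Fintype K] [Algebra F K]
    (hF : Fintype.card F = q) (hK : Fintype.card K = q ^ 3)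
    (a : F) (ha : a ≠ 0)
    (r : K) (hr : r ∉ Set.range (algebraMap F K))
    (hsum : r + r ^ q + r ^ q ^ 2 = 0) :
    (∑ x : F, (algebraMap F K (a * x) + (algebraMap F K x - r)⁻¹
        + (algebraMap F K x - r ^ q)⁻¹ + (algebraMap F K x - r ^ q ^ 2)⁻¹) ^ 4 = 0) ∧
    ∑ x : F, (algebraMap F K (a * x) + (algebraMap F K x - r)⁻¹
        + (algebraMap F K x - r ^ q)⁻¹ + (algebraMap F K x - r ^ q ^ 2)⁻¹) ^ 5
      = (algebraMap F K a) ^ 2 / (r - r ^ q)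
          * (1 - (algebraMap F K a) ^ 2 * (r - r ^ q) ^ 4) := by
  obtain rfl : Fintype.card F = q := hF
  have h27 : 27 ≤ Fintype.card F := by
    rw [hq]; exact Nat.pow_le_pow_right (n := 3) (by norm_num) hn
  have h3 : (3 : K) = 0 := by
    have h : ((Fintype.card F : ℕ) : K) = 0 := by
      rw [← map_natCast (algebraMap F K), FiniteField.cast_card_eq_zero, map_zero]
    rw [hq, Nat.cast_pow] at h
    exact_mod_cast eq_zero_of_pow_eq_zero h
  obtain ⟨d, hd⟩ : ∃ d, d = r - r ^ Fintype.card F := ⟨_, rfl⟩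
  have hd0 : d ≠ 0 := fun h =>
    hr (mem_range_algebraMap_of_pow_card_eq (sub_eq_zero.mp (hd.symm.trans h)).symm)
  have hr₁ : r ^ Fintype.card F = r - d := by rw [hd]; ring
  have hr₂ : r ^ Fintype.card F ^ 2 = r + d := by
    linear_combination hsum - hr₁ - r * h3
  have hr₃ : r ^ Fintype.card F ^ 3 = r := by rw [← hK, FiniteField.pow_card]
  have hs₂ : (r - d) ^ Fintype.card F = r - d - d := by
    rw [← hr₁, ← pow_mul, ← sq, hr₂, hr₁]; linear_combination d * h3
  have hs₃ : (r + d) ^ Fintype.card F = r + d - d := by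
    rw [← hr₂, ← pow_mul, ← pow_succ, hr₃, hr₂]; ring
  have hmul : ∀ s t : K, s ^ Fintype.card F = s - d → t ^ Fintype.card F = t - d → s - t = d →
      ∀ x : F, (algebraMap F K x - s)⁻¹ * (algebraMap F K x - t)⁻¹ =
        d⁻¹ * ((algebraMap F K x - s)⁻¹ - (algebraMap F K x - t)⁻¹) := by
    intro s t hs ht hst x
    have h₁ := algebraMap_sub_ne_zero hd0 hs x
    have h₂ := algebraMap_sub_ne_zero hd0 ht x
    field_simp
    linear_combination -hst
  have huv := hmul r (r - d) hr₁ hs₂ (by ring)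
  have hvw := hmul (r - d) (r + d) hs₂ hs₃ (by linear_combination -d * h3)
  have hwu := hmul (r + d) r hs₃ hr₁ (by ring)
  have hx : ∀ m < 26, ∑ x : F, algebraMap F K x ^ m = 0 := fun m hm =>
    sum_algebraMap_pow_eq_zero (by omega)
  rw [hr₁, hr₂, sub_sub_cancel]
  simp only [map_mul, add_pow_four_of_mul_eq h3 (huv _) (hvw _) (hwu _),
    add_pow_five_of_mul_eq h3 (huv _) (hvw _) (hwu _), Finset.sum_add_distrib,
    Finset.sum_sub_distrib, ← Finset.mul_sum]
  rw [hx 4 (by norm_num), hx 5 (by norm_num)]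
  have hp : ∀ s : K, s ^ Fintype.card F = s - d → ∀ k < 27, 0 < k →
      ∑ x : F, ((algebraMap F K x - s)⁻¹) ^ k = (-d⁻¹) ^ k := by
    intro s hs k hk hk0
    obtain ⟨k, rfl⟩ := Nat.exists_eq_succ_of_ne_zero (ne_of_gt hk0)
    exact sum_inv_algebraMap_sub_pow hd0 hs (by omega)
  have hmix : ∀ s : K, s ^ Fintype.card F = s - d → ∀ j < 27, ∀ k < 27, 0 < k →
      ∑ x : F, algebraMap F K x ^ j * ((algebraMap F K x - s)⁻¹) ^ k =
        ∑ i ∈ Finset.range (j + 1), if i < k then s ^ (j - i) * j.choose i * (-d⁻¹) ^ (k - i)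
          else 0 := fun s hs j hj k hk hk0 =>
    sum_pow_mul_inv_algebraMap_sub_pow hd0 hs (by omega) (by omega) hk0
  simp (disch := norm_num) only [hmix r hr₁, hmix _ hs₂, hmix _ hs₃, hp r hr₁, hp _ hs₂, hp _ hs₃]
  simp only [Finset.sum_range_succ, Finset.sum_range_zero, Nat.choose]
  norm_num
  generalize algebraMap F K a = b
  constructor
  · field_simp
    linear_combination (2 - b * d * r + b * d ^ 2 - b ^ 3 * d ^ 3 * r ^ 3
      - 2 * b ^ 3 * d ^ 5 * r) * h3
  · field_simp
    linear_combination (-2 * b * d * r + 2 * b * d ^ 2 - b ^ 2 * d ^ 2 * r ^ 2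
      + 2 * b ^ 2 * d ^ 3 * r - 2 * b ^ 2 * d ^ 4 + b ^ 3 * d ^ 3 * r ^ 3
      - 3 * b ^ 3 * d ^ 4 * r ^ 2 + 2 * b ^ 3 * d ^ 5 * r - 2 * b ^ 3 * d ^ 6
      + b ^ 4 * d ^ 4 * r ^ 4 + 4 * b ^ 4 * d ^ 6 * r ^ 2 + b ^ 4 * d ^ 8) * h3
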